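/- arXiv:1611.08660 — 4 statements merged into one kernel-verified Lean document; each statement's English description precedes it below -/
import Mathlib

section
/- Let M ≥ 1, let A and B be M×M complex matrices, let w1(1),…,w1(M) and w2(1),…,w2(M−1) be vectors in ℂ^M satisfying A·w1(i+1) = −B·w2(i) for every i with 1 ≤ i ≤ M−1. Let a(1),…,a(M) and b(1),…,b(M−1) be complex scalars, set b(0) = 0, and define s1(k) = a(k) + b(k−1) for k = 1,…,M and s2(k) = a(k) + b(k) for k = 1,…,M−1. Then A·(Σ_{k=1}^{M} s1(k)·w1(k)) + B·(Σ_{k=1}^{M−1} s2(k)·w2(k)) = a(1)·A·w1(1) + Σ_{k=1}^{M−1} (a(k+1) − a(k))·A·w1(k+1). -/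
open Finset in
theorem sum_Icc_one_succ_eq_add {V : Type*} [AddCommMonoid V] (f : ℕ → V) (n : ℕ) :
    ∑ k ∈ Icc 1 (n + 1), f k = f 1 + ∑ k ∈ Icc 1 n, f (k + 1) := by
  induction n with
  | zero => simp
  | succ n ih =>
    rw [sum_Icc_succ_top (by omega), ih, sum_Icc_succ_top (by omega), add_assoc]

open Finset in
/-- Noiseless received signal at destinations D1 and D3 (eq. (33)): under the
interference-cancellation condition (29), the interfering symbols b(k) cancel. -/
theorem received_signal_dest13 (M : ℕ) (hM : 1 ≤ M)
    (A B : Matrix (Fin M) (Fin M) ℂ)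
    (w1 w2 : ℕ → Fin M → ℂ)
    (hcancel : ∀ i : ℕ, 1 ≤ i → i ≤ M - 1 →
      A.mulVec (w1 (i + 1)) = -(B.mulVec (w2 i)))
    (a b : ℕ → ℂ) (hb0 : b 0 = 0)
    (s1 s2 : ℕ → ℂ)
    (hs1 : ∀ k : ℕ, 1 ≤ k → k ≤ M → s1 k = a k + b (k - 1))
    (hs2 : ∀ k : ℕ, 1 ≤ k → k ≤ M - 1 → s2 k = a k + b k) :
    A.mulVec (∑ k ∈ Icc 1 M, s1 k • w1 k) +
      B.mulVec (∑ k ∈ Icc 1 (M - 1), s2 k • w2 k) =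
    a 1 • A.mulVec (w1 1) +
      ∑ k ∈ Icc 1 (M - 1), (a (k + 1) - a k) • A.mulVec (w1 (k + 1)) := by
  obtain ⟨n, rfl⟩ : ∃ n, M = n + 1 := ⟨M - 1, by omega⟩
  simp only [Nat.add_sub_cancel] at *
  rw [sum_Icc_one_succ_eq_add, Matrix.mulVec_add, Matrix.mulVec_sum, Matrix.mulVec_sum,
    add_assoc, ← sum_add_distrib, Matrix.mulVec_smul, hs1 1 le_rfl hM, Nat.sub_self, hb0,
    add_zero]
  congr 1
  refine sum_congr rfl fun k hk => ?_
  obtain ⟨hk1, hkn⟩ := mem_Icc.mp hk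
  have hB : B.mulVec (w2 k) = -A.mulVec (w1 (k + 1)) := by
    rw [hcancel k hk1 hkn, neg_neg]
  rw [Matrix.mulVec_smul, Matrix.mulVec_smul, hB, hs1 (k + 1) (by omega) (by omega),
    hs2 k hk1 hkn, Nat.add_sub_cancel]
  module
end

section
/- Let M ≥ 1, let A and B be M×M complex matrices, let w1(1),…,w1(M) and w2(1),…,w2(M−1) be vectors in ℂ^M satisfying A·w1(i+1) = −B·w2(i) for every i with 1 ≤ i ≤ M−1. Let a(1),…,a(M) and b(1),…,b(M−1) be complex scalars, set b(0) = 0, define s1(k) = a(k) + b(k−1) for k = 1,…,M and s2(k) = a(k) + b(k) for k = 1,…,M−1, and let y = A·(Σ_{k=1}^{M} s1(k)·w1(k)) + B·(Σ_{k=1}^{M−1} s2(k)·w2(k)). Let P be the M×M complex matrix whose k-th column is A·w1(k), and assume P is invertible. Then the first entry of P⁻¹·y equals a(1), and for every k with 2 ≤ k ≤ M, the k-th entry of P⁻¹·y equals a(k) − a(k−1). -/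
open Finset in
/-- Noiseless eq. (35): inverting the matrix P = H_1 whose k-th column is
A·w1(k), destination D1 (or D3) observes a(1) in the first entry and
a(k) − a(k−1) in the k-th entry. Entries are indexed by Fin M, where index k
corresponds to the (k+1)-st entry (1-based). -/
theorem dest13_effective_channel (M : ℕ) (hM : 1 ≤ M)
    (A B : Matrix (Fin M) (Fin M) ℂ)
    (w1 w2 : ℕ → Fin M → ℂ)
    (hcancel : ∀ i : ℕ, 1 ≤ i → i ≤ M - 1 →
      A.mulVec (w1 (i + 1)) = -(B.mulVec (w2 i )))
    (a b : ℕ → ℂ) (hb0 : b 0 = 0)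
    (s1 s2 : ℕ → ℂ)
    (hs1 : ∀ k : ℕ, 1 ≤ k → k ≤ M → s1 k = a k + b (k - 1))
    (hs2 : ∀ k : ℕ, 1 ≤ k → k ≤ M - 1 → s2 k = a k + b k)
    (y : Fin M → ℂ)
    (hy : y = A.mulVec (∑ k ∈ Icc 1 M, s1 k • w1 k) +
      B.mulVec (∑ k ∈ Icc 1 (M - 1), s2 k • w2 k))
    (P : Matrix (Fin M) (Fin M) ℂ)
    (hP : ∀ j k : Fin M, P j k = A.mulVec (w1 (k.val + 1)) j)
    (hPinv : IsUnit P) :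
    (∀ k : Fin M, k.val = 0 → P⁻¹.mulVec y k = a 1) ∧
    (∀ k : Fin M, 1 ≤ k.val →
      P⁻¹.mulVec y k = a (k.val + 1) - a k.val) := by
  obtain ⟨n, rfl⟩ : ∃ n, M = n + 1 := ⟨M - 1, by omega⟩
  have hIcc (m : ℕ) (f : ℕ → Fin (n + 1) → ℂ) :
      ∑ k ∈ Icc 1 m, f k = ∑ k ∈ range m, f (k + 1) := by
    rw [range_eq_Ico, sum_Ico_add' f 0 m 1, zero_add, Ico_add_one_right_eq_Icc]
  let d : ℕ → ℂ := fun k => if k = 0 then a 1 else a (k + 1) - a k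
  have hy_sum : y = ∑ k ∈ range (n + 1), d k • A.mulVec (w1 (k + 1)) := by
    have hB : ∑ k ∈ range n, s2 (k + 1) • B.mulVec (w2 (k + 1)) =
        ∑ k ∈ range n, -((a (k + 1) + b (k + 1)) • A.mulVec (w1 (k + 1 + 1))) := by
      refine sum_congr rfl fun k hk => ?_
      have hkn := mem_range.mp hk
      rw [hcancel (k + 1) (by omega) (by omega), hs2 (k + 1) (by omega) (by omega),
        smul_neg, neg_neg]
    have hA : ∑ k ∈ range (n + 1), s1 (k + 1) • A.mulVec (w1 (k + 1)) =
        ∑ k ∈ range (n + 1), (a (k + 1) + b k) • A.mulVec (w1 (k + 1)) := by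
      refine sum_congr rfl fun k hk => ?_
      have hkn := mem_range.mp hk
      rw [hs1 (k + 1) (by omega) (by omega), Nat.add_sub_cancel]
    rw [hy, Nat.add_sub_cancel, hIcc, hIcc, Matrix.mulVec_sum, Matrix.mulVec_sum]
    simp only [Matrix.mulVec_smul]
    rw [hA, hB, sum_range_succ', sum_range_succ', add_right_comm, ← sum_add_distrib]
    congr 1
    · refine sum_congr rfl fun k _ => ?_
      rw [← sub_eq_add_neg, ← sub_smul]
      simp [d]
    · simp [d, hb0]
  have hPd : P.mulVec (fun k => d k.val) = y := by
    ext j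
    rw [hy_sum, Finset.sum_apply, ← Fin.sum_univ_eq_sum_range
      (fun k => (d k • A.mulVec (w1 (k + 1))) j)]
    rw [Matrix.mulVec_eq_sum, Finset.sum_apply]
    refine sum_congr rfl fun k _ => ?_
    simp only [Pi.smul_apply, MulOpposite.smul_eq_mul_unop, MulOpposite.unop_op,
      Matrix.transpose_apply]
    rw [hP, smul_eq_mul, mul_comm]
  have hinv : P⁻¹.mulVec y = fun k => d k.val := by
    rw [← hPd, Matrix.mulVec_mulVec,
      Matrix.nonsing_inv_mul P ((Matrix.isUnit_iff_isUnit_det P).mp hPinv), Matrix.one_mulVec]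
  refine ⟨fun k hk => ?_, fun k hk => ?_⟩
  · simp [hinv, d, hk]
  · simp only [hinv, d]
    rw [if_neg (by omega)]
end

section
/- Let M ≥ 1, let C and D be M×M complex matrices, let w1(1),…,w1(M) and w2(1),…,w2(M−1) be vectors in ℂ^M satisfying −C·w1(i) = D·w2(i) for every i with 1 ≤ i ≤ M−1. Let a(1),…,a(M) and b(1),…,b(M−1) be complex scalars, set b(0) = 0, define s1(k) = a(k) + b(k−1) for k = 1,…,M and s2(k) = a(k) + b(k) for k = 1,…,M−1, and let y = C·(Σ_{k=1}^{M} s1(k)·w1(k)) + D·(Σ_{k=1}^{M−1} s2(k)·w2(k)). Let Q be the M×M complex matrix whose k-th column equals D·w2(k) for k = 1,…,M−1 and whose M-th column equals C·w1(M), and assume Q is invertible. Then for every k with 1 ≤ k ≤ M−1, the k-th entry of Q⁻¹·y equals b(k) − b(k−1), and the M-th entry of Q⁻¹·y equals a(M) + b(M−1). -/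
open Finset in
/-- Noiseless eq. (36): inverting the matrix Q = H_2 whose first M−1 columns
are D·w2(k) and whose last column is C·w1(M), destination D2 (or D4) observes
b(k) − b(k−1) in the k-th entry (k ≤ M−1) and a(M) + b(M−1) in the last entry.
Entries are indexed by Fin M, where index k corresponds to the (k+1)-st entry
(1-based). -/
theorem dest24_effective_channel (M : ℕ) (hM : 1 ≤ M)
    (C D : Matrix (Fin M) (Fin M) ℂ)
    (w1 w2 : ℕ → Fin M → ℂ)
    (hcancel : ∀ i : ℕ, 1 ≤ i → i ≤ M - 1 →
      -(C.mulVec (w1 i)) = D.mulVec (w2 i))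
    (a b : ℕ → ℂ) (hb0 : b 0 = 0)
    (s1 s2 : ℕ → ℂ)
    (hs1 : ∀ k : ℕ, 1 ≤ k → k ≤ M → s1 k = a k + b (k - 1))
    (hs2 : ∀ k : ℕ, 1 ≤ k → k ≤ M - 1 → s2 k = a k + b k)
    (y : Fin M → ℂ)
    (hy : y = C.mulVec (∑ k ∈ Icc 1 M, s1 k • w1 k) +
      D.mulVec (∑ k ∈ Icc 1 (M - 1), s2 k • w2 k))
    (Q : Matrix (Fin M) (Fin M) ℂ)
    (hQcol : ∀ j k : Fin M, k.val + 1 ≤ M - 1 → Q j k = D.mulVec (w2 (k.val + 1)) j)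
    (hQlast : ∀ j k : Fin M, k.val = M - 1 → Q j k = C.mulVec (w1 M) j)
    (hQinv : IsUnit Q) :
    (∀ k : Fin M, k.val + 1 ≤ M - 1 →
      Q⁻¹.mulVec y k = b (k.val + 1) - b k.val) ∧
    (∀ k : Fin M, k.val = M - 1 → Q⁻¹.mulVec y k = a M + b (M - 1)) := by
  obtain ⟨n, rfl⟩ : ∃ n, M = n + 1 := ⟨M - 1, by omega⟩
  simp only [Nat.add_sub_cancel] at *
  have hIcc (m : ℕ) (f : ℕ → Fin (n + 1) → ℂ) :
      ∑ k ∈ Icc 1 m, f k = ∑ k : Fin m, f (k + 1) := by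
    rw [Fin.sum_univ_eq_sum_range (fun k => f (k + 1)) m, Finset.range_eq_Ico,
      Finset.sum_Ico_add' f 0 m 1]
    rfl
  let v : Fin (n + 1) → ℂ :=
    Fin.snoc (fun k : Fin n => b (k + 1) - b k) (a (n + 1) + b n)
  have hQv : Q.mulVec v = y := by
    have hcol (k : Fin n) : Q.col k.castSucc = D.mulVec (w2 (k + 1)) :=
      funext fun j => hQcol j k.castSucc k.isLt
    have hlast : Q.col (Fin.last n) = C.mulVec (w1 (n + 1)) :=
      funext fun j => hQlast j (Fin.last n) rfl
    rw [hy, hIcc, hIcc, Fin.sum_univ_castSucc, Matrix.mulVec_add, Matrix.mulVec_sum,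
      Matrix.mulVec_sum, Matrix.mulVec_eq_sum, Fin.sum_univ_castSucc, add_right_comm,
      ← Finset.sum_add_distrib]
    congr 1
    · refine Finset.sum_congr rfl fun k _ => ?_
      have hk : (k : ℕ) + 1 ≤ n := k.isLt
      change MulOpposite.op (v k.castSucc) • Q.col k.castSucc = _
      have hC : C.mulVec (w1 (k + 1)) = -D.mulVec (w2 (k + 1)) := by
        rw [← hcancel _ (by omega) hk, neg_neg]
      rw [hcol, op_smul_eq_smul, Matrix.mulVec_smul, Matrix.mulVec_smul, Fin.val_castSucc,
        hC, hs1 _ (by omega) (by omega), hs2 _ (by omega) hk]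
      simp only [v, Fin.snoc_castSucc, Nat.add_sub_cancel]
      module
    · change MulOpposite.op (v (Fin.last n)) • Q.col (Fin.last n) = _
      rw [hlast, op_smul_eq_smul, Matrix.mulVec_smul, Fin.val_last,
        hs1 _ (by omega) le_rfl]
      simp [v]
  have hinv : Q⁻¹.mulVec y = v := by
    rw [← hQv, Matrix.mulVec_mulVec,
      Matrix.nonsing_inv_mul Q ((Matrix.isUnit_iff_isUnit_det Q).mp hQinv), Matrix.one_mulVec]
  rw [hinv]
  refine ⟨fun k hk => ?_, fun k hk => ?_⟩
  · obtain ⟨i, rfl⟩ : ∃ i : Fin n, i.castSucc = k := ⟨⟨k, hk⟩, rfl⟩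
    simp [v]
  · obtain rfl : k = Fin.last n := Fin.ext hk
    simp [v]
end

section
/- Let M ≥ 1, let A and B be M×M complex matrices, let w1(1),…,w1(M) and w2(1),…,w2(M−1) be vectors in ℂ^M satisfying A·w1(i+1) = −B·w2(i) for every i with 1 ≤ i ≤ M−1. Let x1(1),…,x1(M), x3(1),…,x3(M), x2(1),…,x2(M−1), x4(1),…,x4(M−1) be complex scalars; set a(k) = x1(k)+x3(k), b(k) = x2(k)+x4(k), b(0) = 0, s1(k) = a(k)+b(k−1) for k = 1,…,M, s2(k) = a(k)+b(k) for k = 1,…,M−1, and y = A·(Σ_{k=1}^{M} s1(k)·w1(k)) + B·(Σ_{k=1}^{M−1} s2(k)·w2(k)). Let P be the M×M complex matrix whose k-th column is A·w1(k), and assume P is invertible. Then for every k with 1 ≤ k ≤ M, x1(k) = (Σ_{j=1}^{k} (P⁻¹·y)_j) − x3(k). -/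
/-- Summing `f` over the elements of `Fin n` below `k ≤ n` is summing `f` over `range k`. -/
theorem Fin.sum_filter_val_lt {α : Type*} [AddCommMonoid α] {n k : ℕ} (hk : k ≤ n) (f : ℕ → α) :
    ∑ j ∈ Finset.univ.filter (fun j : Fin n => j.val < k), f j = ∑ j ∈ Finset.range k, f j := by
  rw [Finset.sum_filter, Fin.sum_univ_eq_sum_range (fun j => if j < k then f j else 0),
    ← Finset.sum_filter]
  congr 1
  ext j
  simp only [Finset.mem_filter, Finset.mem_range]
  omega

/-- The sum over `Icc 1 n`, shifted to `range n`. -/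
theorem Finset.sum_Icc_one_eq_sum_range {α : Type*} [AddCommMonoid α] (n : ℕ) (f : ℕ → α) :
    ∑ k ∈ Finset.Icc 1 n, f k = ∑ k ∈ Finset.range n, f (k + 1) := by
  rw [Finset.range_eq_Ico, Finset.sum_Ico_add' f 0 n 1]
  rfl


open Finset in
/-- Successive decoding at destination D1: summing the first k entries of
P⁻¹·y (noiseless eq. (35)) and subtracting its own symbol x3(k), D1 recovers
x1(k) for every k = 1,…,M. Entries are indexed by Fin M, where index j
corresponds to the (j+1)-st entry (1-based). -/
theorem dest1_successive_decoding (M : ℕ) (hM : 1 ≤ M)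
    (A B : Matrix (Fin M) (Fin M) ℂ)
    (w1 w2 : ℕ → Fin M → ℂ)
    (hcancel : ∀ i : ℕ, 1 ≤ i → i ≤ M - 1 →
      A.mulVec (w1 (i + 1)) = -(B.mulVec (w2 i)))
    (x1 x3 x2 x4 : ℕ → ℂ)
    (a b : ℕ → ℂ)
    (ha : ∀ k : ℕ, a k = x1 k + x3 k)
    (hb : ∀ k : ℕ, 1 ≤ k → b k = x2 k + x4 k) (hb0 : b 0 = 0)
    (s1 s2 : ℕ → ℂ)
    (hs1 : ∀ k : ℕ, 1 ≤ k → k ≤ M → s1 k = a k + b (k - 1))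
    (hs2 : ∀ k : ℕ, 1 ≤ k → k ≤ M - 1 → s2 k = a k + b k)
    (y : Fin M → ℂ)
    (hy : y = A.mulVec (∑ k ∈ Icc 1 M, s1 k • w1 k) +
      B.mulVec (∑ k ∈ Icc 1 (M - 1), s2 k • w2 k))
    (P : Matrix (Fin M) (Fin M) ℂ)
    (hP : ∀ j k : Fin M, P j k = A.mulVec (w1 (k.val + 1)) j)
    (hPinv : IsUnit P) :
    ∀ k : ℕ, 1 ≤ k → k ≤ M →
      x1 k = (∑ j ∈ Finset.univ.filter (fun j : Fin M => j.val < k),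
        P⁻¹.mulVec y j) - x3 k := by
  intro k hk hkM
  obtain ⟨N, rfl⟩ : ∃ N, M = N + 1 := ⟨M - 1, by omega⟩
  set d : ℕ → ℂ := fun k => a (k + 1) - if k = 0 then 0 else a k with hd
  have hPd : y = P.mulVec (fun j => d j) := by
    have hcols : P.mulVec (fun j => d j) =
        ∑ j ∈ Finset.range (N + 1), d j • A.mulVec (w1 (j + 1)) := by
      rw [← Fin.sum_univ_eq_sum_range (fun j => d j • A.mulVec (w1 (j + 1)))]
      ext i
      simp [Matrix.mulVec_eq_sum, hP]
    have hinit : d 0 = s1 1 := by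
      simp [hd, hs1 1 le_rfl hM, hb0]
    have hdiff : ∀ i < N, d (i + 1) • A.mulVec (w1 (i + 1 + 1)) =
        s1 (i + 1 + 1) • A.mulVec (w1 (i + 1 + 1)) + s2 (i + 1) • B.mulVec (w2 (i + 1)) := by
      intro i hi
      have hB : B.mulVec (w2 (i + 1)) = -A.mulVec (w1 (i + 1 + 1)) := by
        rw [hcancel (i + 1) (by omega) (by omega), neg_neg]
      have hc : d (i + 1) = s1 (i + 1 + 1) - s2 (i + 1) := by
        rw [hs1 (i + 1 + 1) (by omega) (by omega), hs2 (i + 1) (by omega) (by omega)]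
        simp [hd]
      rw [hB, hc, smul_neg, sub_smul, sub_eq_add_neg]
    rw [hy, hcols, Finset.sum_Icc_one_eq_sum_range, Finset.sum_Icc_one_eq_sum_range,
      Matrix.mulVec_sum, Matrix.mulVec_sum, Nat.add_sub_cancel, Finset.sum_range_succ',
      Finset.sum_range_succ' (fun j => d j • A.mulVec (w1 (j + 1))),
      Finset.sum_congr rfl fun i hi => hdiff i (Finset.mem_range.mp hi),
      Finset.sum_add_distrib, hinit]
    simp only [Matrix.mulVec_smul, zero_add]
    abel
  have htel : ∀ m, ∑ j ∈ Finset.range (m + 1), d j = a (m + 1) := by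
    intro m
    induction m with
    | zero => simp [hd]
    | succ m ih => rw [Finset.sum_range_succ, ih]; simp [hd]
  obtain ⟨m, rfl⟩ : ∃ m, k = m + 1 := ⟨k - 1, by omega⟩
  rw [hPd, Matrix.mulVec_mulVec,
    Matrix.nonsing_inv_mul P ((Matrix.isUnit_iff_isUnit_det P).mp hPinv),
    Matrix.one_mulVec, Fin.sum_filter_val_lt hkM d, htel, ha, add_sub_cancel_right]
end
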